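/- Persistency of excitation for isotropic Gaussian inputs: let γ > 0 and let the input be u(t) := σ·h(t) with σ² := γ²/n_u, where h(0),…,h(τ−1) are i.i.d. standard Gaussian vectors in ℝ^{n_u} independent of the noise sequence g. Then for every initial state x₀ ∈ ℝ^{n_x} and every i ∈ {1,…,N}: (1/τ)·Σ_{t=0}^{τ−1} E[‖ΔA_i x(t) + ΔB_i u(t)‖²_{Σ_w^{-1}}] ≥ γ² · inf_{p ∈ Δ_N} λ_mean(Σ_{j=1}^{N} p_j W_j) + min_{j∈{1,…,N}} (1/τ)·tr(S_wᵀ Q_j S_w), where Δ_N := {p ∈ ℝ^N : p_j ≥ 0 for all j, Σ_j p_j = 1} is the standard simplex and λ_mean(X) := tr(X)/(n_u·τ) denotes the mean of the eigenvalues of an n_u·τ × n_u·τ symmetric matrix X. -/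

import Mathlib

open Matrix MeasureTheory ProbabilityTheory
open scoped Kronecker

noncomputable section

def stdGaussianVec (n : ℕ) : Measure (Fin n → ℝ) :=
  Measure.pi fun _ => gaussianReal 0 1

instance (n : ℕ) : IsProbabilityMeasure (stdGaussianVec n) := by
  unfold stdGaussianVec; infer_instance

def stdGaussianSeq (T n : ℕ) : Measure (Fin T → Fin n → ℝ) :=
  Measure.pi fun _ => stdGaussianVec n

instance (T n : ℕ) : IsProbabilityMeasure (stdGaussianSeq T n) := by
  unfold stdGaussianSeq; infer_instance

def wnormSq {n : ℕ} (M : Matrix (Fin n) (Fin n) ℝ) (v : Fin n → ℝ) : ℝ :=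
  v ⬝ᵥ M.mulVec v

def SuMat (T nx nu : ℕ) (Astar : Matrix (Fin nx) (Fin nx) ℝ)
    (Bstar : Matrix (Fin nx) (Fin nu) ℝ) :
    Matrix (Fin T × Fin nx) (Fin T × Fin nu) ℝ :=
  Matrix.of fun p q =>
    if (q.1 : ℕ) < (p.1 : ℕ) then (Astar ^ ((p.1 : ℕ) - 1 - (q.1 : ℕ)) * Bstar) p.2 q.2 else 0

def SwMat (T nx : ℕ) (Astar sqrtSigw : Matrix (Fin nx) (Fin nx) ℝ) :
    Matrix (Fin T × Fin nx) (Fin T × Fin nx) ℝ :=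
  Matrix.of fun p q =>
    if (q.1 : ℕ) < (p.1 : ℕ) then (Astar ^ ((p.1 : ℕ) - 1 - (q.1 : ℕ)) * sqrtSigw) p.2 q.2 else 0

def Qblk (T nx : ℕ) (M ΔA : Matrix (Fin nx) (Fin nx) ℝ) :
    Matrix (Fin T × Fin nx) (Fin T × Fin nx) ℝ :=
  (1 : Matrix (Fin T) (Fin T) ℝ) ⊗ₖ (ΔAᵀ * M * ΔA)

def Rblk (T nx nu : ℕ) (M : Matrix (Fin nx) (Fin nx) ℝ) (ΔB : Matrix (Fin nx) (Fin nu) ℝ) :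
    Matrix (Fin T × Fin nu) (Fin T × Fin nu) ℝ :=
  (1 : Matrix (Fin T) (Fin T) ℝ) ⊗ₖ (ΔBᵀ * M * ΔB)

def Nblk (T nx nu : ℕ) (M ΔA : Matrix (Fin nx) (Fin nx) ℝ) (ΔB : Matrix (Fin nx) (Fin nu) ℝ) :
    Matrix (Fin T × Fin nu) (Fin T × Fin nx) ℝ :=
  (1 : Matrix (Fin T) (Fin T) ℝ) ⊗ₖ (ΔBᵀ * M * ΔA)

def Wmat (T nx nu : ℕ) (Astar M ΔA : Matrix (Fin nx) (Fin nx) ℝ)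
    (Bstar ΔB : Matrix (Fin nx) (Fin nu) ℝ) :
    Matrix (Fin T × Fin nu) (Fin T × Fin nu) ℝ :=
  Rblk T nx nu M ΔB + (SuMat T nx nu Astar Bstar)ᵀ * Qblk T nx M ΔA * SuMat T nx nu Astar Bstar
    + Nblk T nx nu M ΔA ΔB * SuMat T nx nu Astar Bstar
    + (Nblk T nx nu M ΔA ΔB * SuMat T nx nu Astar Bstar)ᵀ

def lambdaMax {n : ℕ} (M : Matrix (Fin n) (Fin n) ℝ) : ℝ :=
  sSup {r : ℝ | ∃ v : Fin n → ℝ, v ≠ 0 ∧ M.mulVec v = r • v}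

end

/-- A finite family of square-integrable random variables which is centred and orthonormal. -/
structure IsWhite {Ω ι : Type*} [DecidableEq ι] [MeasurableSpace Ω] (Z : ι → Ω → ℝ)
    (μ : Measure Ω) : Prop where
  memLp : ∀ a, MemLp (Z a) 2 μ
  mean : ∀ a, ∫ ω, Z a ω ∂μ = 0
  cov : ∀ a b, ∫ ω, Z a ω * Z b ω ∂μ = if a = b then 1 else 0

namespace IsWhite

variable {Ω Ω' ι κ : Type*} [DecidableEq ι] [DecidableEq κ] [MeasurableSpace Ω]
  [MeasurableSpace Ω'] {μ : Measure Ω} {ν : Measure Ω'}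

theorem gaussianReal : IsWhite (fun (_ : Unit) (y : ℝ) => y) (gaussianReal 0 1) where
  memLp _ := memLp_id_gaussianReal 2
  mean _ := by simp
  cov a b := by
    have h := variance_id_gaussianReal (μ := 0) (v := 1)
    rw [variance_of_integral_eq_zero aemeasurable_id (by simp)] at h
    simpa [pow_two] using h

theorem pi [IsProbabilityMeasure μ] {T : Type*} [Fintype T] [DecidableEq T] {Z : ι → Ω → ℝ}
    (h : IsWhite Z μ) :
    IsWhite (fun (p : T × ι) (ω : T → Ω) => Z p.2 (ω p.1)) (Measure.pi fun _ : T => μ) where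
  memLp p := (h.memLp p.2).comp_measurePreserving (measurePreserving_eval (fun _ : T => μ) p.1)
  mean p := (integral_comp_eval (μ := fun _ : T => μ) (h.memLp p.2).1).trans (h.mean p.2)
  cov := by
    rintro ⟨s, a⟩ ⟨t, b⟩
    have hs := measurePreserving_eval (fun _ : T => μ) s
    have ht := measurePreserving_eval (fun _ : T => μ) t
    by_cases hst : s = t
    · subst hst
      have : ∫ ω : T → Ω, Z a (ω s) * Z b (ω s) ∂(Measure.pi fun _ : T => μ)
          = ∫ ω, Z a ω * Z b ω ∂μ :=
        integral_comp_eval (μ := fun _ : T => μ) ((h.memLp a).1.mul (h.memLp b).1)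
      simp [this, h.cov]
    · have hind : IndepFun (fun ω : T → Ω => ω s) (fun ω => ω t) (Measure.pi fun _ : T => μ) :=
        (iIndepFun_pi (μ := fun _ : T => μ) (X := fun _ => id)
          (fun _ => aemeasurable_id)).indepFun hst
      have hmul := hind.integral_fun_comp_mul_comp (f := Z a) (g := Z b)
        hs.measurable.aemeasurable ht.measurable.aemeasurable
        (by rw [hs.map_eq]; exact (h.memLp a).1) (by rw [ht.map_eq]; exact (h.memLp b).1)
      have hmean : ∫ ω : T → Ω, Z a (ω s) ∂(Measure.pi fun _ : T => μ) = 0 :=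
        (integral_comp_eval (μ := fun _ : T => μ) (h.memLp a).1).trans (h.mean a)
      simp only [hmul, hmean, Prod.mk.injEq, hst, false_and, if_false, zero_mul]

theorem prod [IsProbabilityMeasure μ] [IsProbabilityMeasure ν] {Z : ι → Ω → ℝ} {Y : κ → Ω' → ℝ}
    (hZ : IsWhite Z μ) (hY : IsWhite Y ν) :
    IsWhite (Sum.elim (fun a (ω : Ω × Ω') => Z a ω.1) (fun b ω => Y b ω.2)) (μ.prod ν) where
  memLp := by
    rintro (a | b)
    · exact (hZ.memLp a).comp_fst ν
    · exact (hY.memLp b).comp_snd μ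
  mean := by
    rintro (a | b)
    · simp [integral_fun_fst (μ := μ) (ν := ν) (Z a), hZ.mean]
    · simp [integral_fun_snd (μ := μ) (ν := ν) (Y b), hY.mean]
  cov := by
    rintro (a | b) (c | d)
    · simp [integral_fun_fst (μ := μ) (ν := ν) (fun ω => Z a ω * Z c ω), hZ.cov]
    · simp [integral_prod_mul, hZ.mean]
    · simp [mul_comm (Y b _), integral_prod_mul, hY.mean]
    · simp [integral_fun_snd (μ := μ) (ν := ν) (fun ω => Y b ω * Y d ω), hY.cov]

variable [Fintype ι] [IsProbabilityMeasure μ] {Z : ι → Ω → ℝ}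

theorem memLp_affine (h : IsWhite Z μ) (c : ℝ) (k : ι → ℝ) :
    MemLp (fun ω => c + ∑ a, k a * Z a ω) 2 μ :=
  (memLp_const c).add (memLp_finsetSum _ fun a _ => (h.memLp a).const_mul (k a))

theorem integral_affine_mul (h : IsWhite Z μ) (c d : ℝ) (k l : ι → ℝ) :
    ∫ ω, (c + ∑ a, k a * Z a ω) * (d + ∑ a, l a * Z a ω) ∂μ = c * d + ∑ a, k a * l a := by
  have hint (a : ι) : Integrable (Z a) μ := (h.memLp a).integrable one_le_two
  have hlin (l : ι → ℝ) : Integrable (fun ω => ∑ a, l a * Z a ω) μ :=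
    integrable_finsetSum _ fun a _ => (hint a).const_mul _
  have hlin0 (l : ι → ℝ) : ∫ ω, ∑ a, l a * Z a ω ∂μ = 0 := by
    rw [integral_finsetSum _ fun a _ => (hint a).const_mul _]
    simp [integral_const_mul, h.mean]
  have hmul (a b : ι) : Integrable (fun ω => k a * l b * (Z a ω * Z b ω)) μ :=
    ((h.memLp a).integrable_mul (h.memLp b)).const_mul _
  have hsum (a : ι) : Integrable (fun ω => ∑ b, k a * l b * (Z a ω * Z b ω)) μ :=
    integrable_finsetSum _ fun b _ => hmul a b
  have hquad : Integrable (fun ω => ∑ a, ∑ b, k a * l b * (Z a ω * Z b ω)) μ :=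
    integrable_finsetSum _ fun a _ => hsum a
  have hexp (ω : Ω) : (c + ∑ a, k a * Z a ω) * (d + ∑ a, l a * Z a ω)
      = ((c * d + c * ∑ a, l a * Z a ω) + d * ∑ a, k a * Z a ω)
        + ∑ a, ∑ b, k a * l b * (Z a ω * Z b ω) := by
    have : ∑ a, ∑ b, k a * l b * (Z a ω * Z b ω)
        = (∑ a, k a * Z a ω) * ∑ b, l b * Z b ω := by
      rw [Finset.sum_mul_sum]
      exact Finset.sum_congr rfl fun a _ => Finset.sum_congr rfl fun b _ => by ring
    rw [this]; ring
  simp_rw [hexp]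
  have hlow : Integrable (fun ω => c * d + c * ∑ a, l a * Z a ω) μ :=
    (integrable_const _).add ((hlin l).const_mul c)
  have haff : Integrable (fun ω => c * d + c * ∑ a, l a * Z a ω + d * ∑ a, k a * Z a ω) μ :=
    hlow.add ((hlin k).const_mul d)
  rw [integral_add haff hquad, integral_add hlow ((hlin k).const_mul d),
    integral_add (integrable_const _) ((hlin l).const_mul c), integral_const,
    integral_const_mul, integral_const_mul, hlin0, hlin0, integral_finsetSum _ fun a _ => hsum a]
  simp_rw [integral_finsetSum _ fun b _ => hmul _ b, integral_const_mul, h.cov]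
  simp

/-- The second moment of an affine image of a white vector. -/
theorem integral_wnormSq (h : IsWhite Z μ) {n : ℕ} (M : Matrix (Fin n) (Fin n) ℝ)
    (d : Fin n → ℝ) (K : Matrix (Fin n) ι ℝ) :
    ∫ ω, wnormSq M (d + K *ᵥ fun a => Z a ω) ∂μ = wnormSq M d + (Kᵀ * M * K).trace := by
  have hexp (v : Fin n → ℝ) : wnormSq M v = ∑ p, ∑ q, M p q * (v p * v q) := by
    simp only [wnormSq, dotProduct, mulVec, Finset.mul_sum]
    exact Finset.sum_congr rfl fun p _ => Finset.sum_congr rfl fun q _ => by ring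
  have hint (p q : Fin n) : Integrable (fun ω => M p q *
      ((d p + ∑ a, K p a * Z a ω) * (d q + ∑ a, K q a * Z a ω))) μ :=
    ((h.memLp_affine (d p) (K p)).integrable_mul (h.memLp_affine (d q) (K q))).const_mul _
  have htr : (Kᵀ * M * K).trace = ∑ p, ∑ q, M p q * ∑ a, K p a * K q a := by
    simp only [trace, diag_apply, mul_apply, transpose_apply, Finset.sum_mul, Finset.mul_sum]
    conv_lhs => rw [Finset.sum_comm]
    conv_rhs => rw [Finset.sum_comm]
    refine Finset.sum_congr rfl fun q _ => ?_
    rw [Finset.sum_comm]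
    exact Finset.sum_congr rfl fun p _ => Finset.sum_congr rfl fun a _ => by ring
  simp_rw [hexp, htr]
  simp only [Pi.add_apply, mulVec, dotProduct]
  rw [integral_finsetSum _ fun p _ => integrable_finsetSum _ fun q _ => hint p q]
  simp_rw [integral_finsetSum _ fun q _ => hint _ q, integral_const_mul, h.integral_affine_mul,
    mul_add, Finset.sum_add_distrib]

end IsWhite

theorem isWhite_stdGaussianVec (n : ℕ) :
    IsWhite (fun (k : Fin n) (y : Fin n → ℝ) => y k) (stdGaussianVec n) where
  memLp k := (IsWhite.gaussianReal.pi (T := Fin n)).memLp (k, ())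
  mean k := (IsWhite.gaussianReal.pi (T := Fin n)).mean (k, ())
  cov k l := by
    simpa [stdGaussianVec] using (IsWhite.gaussianReal.pi (T := Fin n)).cov (k, ()) (l, ())

theorem isWhite_stdGaussianSeq (T n : ℕ) :
    IsWhite (fun (p : Fin T × Fin n) (ω : Fin T → Fin n → ℝ) => ω p.1 p.2)
      (stdGaussianSeq T n) :=
  (isWhite_stdGaussianVec n).pi

/-- Variation of constants for a linear recursion over a finite horizon. -/
theorem linear_recursion_eq_sum {n T : ℕ} (A : Matrix (Fin n) (Fin n) ℝ) (x : ℕ → Fin n → ℝ)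
    (v : Fin T → Fin n → ℝ) (hx : ∀ t : Fin T, x ((t : ℕ) + 1) = A *ᵥ x t + v t)
    (t : ℕ) (ht : t ≤ T) :
    x t = (A ^ t) *ᵥ x 0 + ∑ s : Fin T, if (s : ℕ) < t then (A ^ (t - 1 - s)) *ᵥ v s else 0 := by
  induction t with
  | zero => simp
  | succ t ih =>
    have hsplit (s : Fin T) :
        (if (s : ℕ) < t + 1 then (A ^ (t + 1 - 1 - s)) *ᵥ v s else 0)
          = A *ᵥ (if (s : ℕ) < t then (A ^ (t - 1 - s)) *ᵥ v s else 0)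
            + if s = ⟨t, ht⟩ then v s else 0 := by
      rcases lt_trichotomy (s : ℕ) t with h | h | h
      · have h1 : t + 1 - 1 - (s : ℕ) = (t - 1 - s) + 1 := by omega
        have h2 : s ≠ ⟨t, ht⟩ := fun h' => by simp [h'] at h
        rw [if_pos (by omega), if_pos h, if_neg h2, h1, pow_succ', ← mulVec_mulVec, add_zero]
      · have h2 : s = ⟨t, ht⟩ := Fin.ext h
        subst h2
        simp
      · have h2 : s ≠ ⟨t, ht⟩ := fun h' => by simp [h'] at h
        rw [if_neg (by omega), if_neg (by omega), if_neg h2]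
        simp
    rw [Finset.sum_congr rfl fun s _ => hsplit s, Finset.sum_add_distrib, hx ⟨t, ht⟩,
      ih (by omega), mulVec_add, mulVec_mulVec, ← pow_succ', mulVec_sum]
    simp [add_assoc]

/-- The rows of `K` in the block `t`. -/
def rowBlock {n T : ℕ} {ι : Type*} (K : Matrix (Fin T × Fin n) ι ℝ) (t : Fin T) :
    Matrix (Fin n) ι ℝ :=
  K.submatrix (fun p => (t, p)) id

theorem sum_trace_rowBlock {n T : ℕ} {ι : Type*} [Fintype ι] (M : Matrix (Fin n) (Fin n) ℝ)
    (K : Matrix (Fin T × Fin n) ι ℝ) :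
    ∑ t, ((rowBlock K t)ᵀ * M * rowBlock K t).trace
      = (Kᵀ * ((1 : Matrix (Fin T) (Fin T) ℝ) ⊗ₖ M) * K).trace := by
  simp only [trace, diag_apply]
  rw [Finset.sum_comm]
  refine Finset.sum_congr rfl fun a _ => ?_
  simp [mul_apply, rowBlock, Fintype.sum_prod_type, kroneckerMap_apply, one_apply]

theorem trace_fromCols_transpose_mul {m ι κ : Type*} [Fintype m] [Fintype ι] [Fintype κ]
    (Q : Matrix m m ℝ) (K : Matrix m ι ℝ) (L : Matrix m κ ℝ) :
    ((fromCols K L)ᵀ * Q * fromCols K L).trace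
      = (Kᵀ * Q * K).trace + (Lᵀ * Q * L).trace := by
  simp [trace, mul_apply, Fintype.sum_sum_type]

theorem Wmat_eq_transpose_mul_mul (T nx nu : ℕ) (Astar M ΔA : Matrix (Fin nx) (Fin nx) ℝ)
    (hM : Mᵀ = M) (Bstar ΔB : Matrix (Fin nx) (Fin nu) ℝ) :
    Wmat T nx nu Astar M ΔA Bstar ΔB
      = ((1 : Matrix (Fin T) (Fin T) ℝ) ⊗ₖ ΔA * SuMat T nx nu Astar Bstar
            + (1 : Matrix (Fin T) (Fin T) ℝ) ⊗ₖ ΔB)ᵀ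
          * ((1 : Matrix (Fin T) (Fin T) ℝ) ⊗ₖ M)
          * ((1 : Matrix (Fin T) (Fin T) ℝ) ⊗ₖ ΔA * SuMat T nx nu Astar Bstar
            + (1 : Matrix (Fin T) (Fin T) ℝ) ⊗ₖ ΔB) := by
  have h {a b c : ℕ} (X : Matrix (Fin a) (Fin b) ℝ) (Y : Matrix (Fin b) (Fin c) ℝ) :
      (1 : Matrix (Fin T) (Fin T) ℝ) ⊗ₖ (X * Y)
        = (1 : Matrix (Fin T) (Fin T) ℝ) ⊗ₖ X * (1 : Matrix (Fin T) (Fin T) ℝ) ⊗ₖ Y := by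
    rw [← mul_kronecker_mul, one_mul]
  have ht {a b : ℕ} (X : Matrix (Fin a) (Fin b) ℝ) :
      ((1 : Matrix (Fin T) (Fin T) ℝ) ⊗ₖ X)ᵀ = (1 : Matrix (Fin T) (Fin T) ℝ) ⊗ₖ Xᵀ := by
    rw [← kroneckerMap_transpose, transpose_one]
  simp only [Wmat, Rblk, Qblk, Nblk, h, transpose_add, transpose_mul, ht, transpose_transpose, hM,
    Matrix.add_mul, Matrix.mul_add, Matrix.mul_assoc]
  abel

theorem Qblk_eq_transpose_mul_mul (T nx : ℕ) (M ΔA : Matrix (Fin nx) (Fin nx) ℝ) :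
    Qblk T nx M ΔA
      = ((1 : Matrix (Fin T) (Fin T) ℝ) ⊗ₖ ΔA)ᵀ * ((1 : Matrix (Fin T) (Fin T) ℝ) ⊗ₖ M)
          * ((1 : Matrix (Fin T) (Fin T) ℝ) ⊗ₖ ΔA) := by
  rw [← kroneckerMap_transpose, transpose_one, ← mul_kronecker_mul, ← mul_kronecker_mul,
    one_mul, one_mul, Qblk]

theorem one_kronecker_mulVec {a b T : ℕ} (X : Matrix (Fin a) (Fin b) ℝ)
    (v : Fin T × Fin b → ℝ) (t : Fin T) (p : Fin a) :
    (((1 : Matrix (Fin T) (Fin T) ℝ) ⊗ₖ X) *ᵥ v) (t, p) = (X *ᵥ fun k => v (t, k)) p := by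
  simp [mulVec, dotProduct, Fintype.sum_prod_type, kroneckerMap_apply, one_apply]

theorem SuMat_mulVec {T nx nu : ℕ} (Astar : Matrix (Fin nx) (Fin nx) ℝ)
    (Bstar : Matrix (Fin nx) (Fin nu) ℝ) (u : Fin T → Fin nu → ℝ) (t : Fin T) (p : Fin nx) :
    (SuMat T nx nu Astar Bstar *ᵥ fun q => u q.1 q.2) (t, p)
      = (∑ s : Fin T, if (s : ℕ) < t then (Astar ^ ((t : ℕ) - 1 - s)) *ᵥ (Bstar *ᵥ u s) else 0) p
      := by
  rw [Finset.sum_apply]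
  simp only [SuMat, mulVec, dotProduct, Fintype.sum_prod_type, of_apply]
  refine Finset.sum_congr rfl fun s _ => ?_
  split_ifs with h
  · rw [mulVec_mulVec]
    rfl
  · simp

theorem SwMat_eq_SuMat (T nx : ℕ) (Astar L : Matrix (Fin nx) (Fin nx) ℝ) :
    SwMat T nx Astar L = SuMat T nx nx Astar L := rfl

/-- The infimum of the convex combinations of a finite family is at most each member. -/
theorem sInf_convexCombination_le {N : ℕ} (a : Fin N → ℝ) (i : Fin N) :
    sInf {r : ℝ | ∃ p : Fin N → ℝ, (∀ j, 0 ≤ p j) ∧ (∑ j, p j) = 1 ∧ r = ∑ j, p j * a j}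
      ≤ a i := by
  refine csInf_le ⟨-∑ j, |a j|, ?_⟩ ⟨Pi.single i 1, fun j => ?_, by simp, by
    simp [Pi.single_apply]⟩
  · rintro r ⟨p, hp, hsum, rfl⟩
    rw [← Finset.sum_neg_distrib]
    refine Finset.sum_le_sum fun j _ => ?_
    have hj : p j ≤ 1 := hsum ▸ Finset.single_le_sum (fun k _ => hp k) (Finset.mem_univ j)
    nlinarith [neg_abs_le (a j), abs_nonneg (a j), hp j]
  · by_cases h : j = i <;> simp [h]

/-- Lemma 3.4 of the paper: persistency of excitation for isotropic Gaussian inputs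
`u(t) = σ·h(t)` with `σ² = γ²/n_u`. -/
theorem PE_isotropic_gaussian
    (nx nu N τ : ℕ) (hnx : 1 ≤ nx) (hnu : 1 ≤ nu) (hN : 1 ≤ N) (hτ : 1 ≤ τ)
    (Astar : Matrix (Fin nx) (Fin nx) ℝ) (Bstar : Matrix (Fin nx) (Fin nu) ℝ)
    (Sigw sqrtSigw : Matrix (Fin nx) (Fin nx) ℝ)
    (hSigw : Sigw.PosDef) (hsqrtW : sqrtSigw.PosSemidef) (hsqrtW2 : sqrtSigw * sqrtSigw = Sigw)
    (A : Fin N → Matrix (Fin nx) (Fin nx) ℝ) (B : Fin N → Matrix (Fin nx) (Fin nu) ℝ)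
    (γ : ℝ) (hγ : 0 < γ)
    (x₀ : Fin nx → ℝ) (i : Fin N)
    (x : ℕ → ((Fin τ → Fin nu → ℝ) × (Fin τ → Fin nx → ℝ)) → (Fin nx → ℝ))
    (hx0 : ∀ ω, x 0 ω = x₀)
    (hxrec : ∀ (t : Fin τ) ω,
      x ((t : ℕ) + 1) ω =
        Astar.mulVec (x (t : ℕ) ω)
          + Bstar.mulVec (Real.sqrt (γ ^ 2 / nu) • ω.1 t)
          + sqrtSigw.mulVec (ω.2 t)) :
    (1 / (τ : ℝ)) *
        (∑ t : Fin τ,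
          ∫ ω, wnormSq Sigw⁻¹ ((Astar - A i).mulVec (x (t : ℕ) ω)
              + (Bstar - B i).mulVec (Real.sqrt (γ ^ 2 / nu) • ω.1 t))
            ∂((stdGaussianSeq τ nu).prod (stdGaussianSeq τ nx)))
      ≥ γ ^ 2 *
          sInf {r : ℝ | ∃ p : Fin N → ℝ, (∀ j, 0 ≤ p j) ∧ (∑ j, p j) = 1 ∧
            r = (∑ j, p j • Wmat τ nx nu Astar Sigw⁻¹ (Astar - A j) Bstar (Bstar - B j)).trace
                  / ((nu : ℝ) * (τ : ℝ))}
        + ⨅ j : Fin N, (1 / (τ : ℝ)) *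
            ((SwMat τ nx Astar sqrtSigw)ᵀ * Qblk τ nx Sigw⁻¹ (Astar - A j) *
              SwMat τ nx Astar sqrtSigw).trace := by
  set σ := Real.sqrt (γ ^ 2 / nu)
  have hσ : σ ^ 2 = γ ^ 2 / nu := Real.sq_sqrt (by positivity)
  set M := Sigw⁻¹
  have hMpd : M.PosDef := hSigw.inv
  have hMt : Mᵀ = M := by simpa using hMpd.isHermitian.eq
  set ΔA := Astar - A i with hΔA
  set ΔB := Bstar - B i with hΔB
  set K : Matrix (Fin τ × Fin nx) (Fin τ × Fin nu) ℝ :=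
    (1 : Matrix (Fin τ) (Fin τ) ℝ) ⊗ₖ ΔA * SuMat τ nx nu Astar Bstar
      + (1 : Matrix (Fin τ) (Fin τ) ℝ) ⊗ₖ ΔB with hK
  set L : Matrix (Fin τ × Fin nx) (Fin τ × Fin nx) ℝ :=
    (1 : Matrix (Fin τ) (Fin τ) ℝ) ⊗ₖ ΔA * SwMat τ nx Astar sqrtSigw with hL
  have hwhite := (isWhite_stdGaussianSeq τ nu).prod (isWhite_stdGaussianSeq τ nx)
  have hresidual (t : Fin τ) (ω : (Fin τ → Fin nu → ℝ) × (Fin τ → Fin nx → ℝ)) :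
      ΔA *ᵥ x t ω + ΔB *ᵥ (σ • ω.1 t)
        = ΔA *ᵥ ((Astar ^ (t : ℕ)) *ᵥ x₀) + rowBlock (fromCols (σ • K) L) t *ᵥ
            fun a => Sum.elim (fun p (ω : (Fin τ → Fin nu → ℝ) × (Fin τ → Fin nx → ℝ)) =>
              ω.1 p.1 p.2) (fun p ω => ω.2 p.1 p.2) a ω := by
    have hsol := linear_recursion_eq_sum Astar (fun t => x t ω)
      (fun s => Bstar *ᵥ (σ • ω.1 s) + sqrtSigw *ᵥ ω.2 s)
      (fun s => by rw [hxrec s ω, add_assoc]) t t.2.le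
    have hsol' : x t ω = (Astar ^ (t : ℕ)) *ᵥ x₀
        + (fun p => (SuMat τ nx nu Astar Bstar *ᵥ fun q => (σ • ω.1) q.1 q.2) (t, p))
        + (fun p => (SwMat τ nx Astar sqrtSigw *ᵥ fun q => ω.2 q.1 q.2) (t, p)) := by
      simp only [SwMat_eq_SuMat, SuMat_mulVec]
      rw [hsol, hx0, add_assoc]
      congr 1
      funext p
      simp only [Pi.add_apply, Finset.sum_apply, ← Finset.sum_add_distrib]
      refine Finset.sum_congr rfl fun s _ => ?_
      split_ifs <;> simp [mulVec_add]
    rw [hsol', mulVec_add, mulVec_add, add_assoc, add_assoc]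
    congr 1
    funext p
    have hrow : (rowBlock (fromCols (σ • K) L) t *ᵥ
            fun a => Sum.elim (fun p (ω : (Fin τ → Fin nu → ℝ) × (Fin τ → Fin nx → ℝ)) =>
              ω.1 p.1 p.2) (fun p ω => ω.2 p.1 p.2) a ω) p
        = (K *ᵥ fun q => (σ • ω.1) q.1 q.2) (t, p) + (L *ᵥ fun q => ω.2 q.1 q.2) (t, p) := by
      simp [rowBlock, mulVec, dotProduct, Fintype.sum_sum_type, mul_left_comm, mul_assoc]
    rw [hrow, hK, hL, add_mulVec, ← mulVec_mulVec, ← mulVec_mulVec, Pi.add_apply,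
      Pi.add_apply, Pi.add_apply, one_kronecker_mulVec, one_kronecker_mulVec,
      one_kronecker_mulVec]
    change _ + (_ + (ΔB *ᵥ fun k => (σ • ω.1) t k) p) = _
    ring
  have hlhs : ∑ t : Fin τ, ∫ ω, wnormSq M (ΔA *ᵥ x t ω + ΔB *ᵥ (σ • ω.1 t))
        ∂((stdGaussianSeq τ nu).prod (stdGaussianSeq τ nx))
      = ∑ t : Fin τ, wnormSq M (ΔA *ᵥ ((Astar ^ (t : ℕ)) *ᵥ x₀))
        + (γ ^ 2 / nu * (Wmat τ nx nu Astar M ΔA Bstar ΔB).trace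
          + ((SwMat τ nx Astar sqrtSigw)ᵀ * Qblk τ nx M ΔA * SwMat τ nx Astar sqrtSigw).trace) := by
    simp_rw [hresidual, hwhite.integral_wnormSq]
    rw [Finset.sum_add_distrib, sum_trace_rowBlock, trace_fromCols_transpose_mul,
      Wmat_eq_transpose_mul_mul _ _ _ _ _ _ hMt, Qblk_eq_transpose_mul_mul, ← hK, ← hσ]
    congr 2
    · simp [pow_two, mul_assoc]
    · simp only [hL, transpose_mul, Matrix.mul_assoc]
  have hnonneg : 0 ≤ ∑ t : Fin τ, wnormSq M (ΔA *ᵥ ((Astar ^ (t : ℕ)) *ᵥ x₀)) :=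
    Finset.sum_nonneg fun t _ => by
      simpa [wnormSq] using hMpd.posSemidef.dotProduct_mulVec_nonneg
        (ΔA *ᵥ ((Astar ^ (t : ℕ)) *ᵥ x₀))
  have hinf := sInf_convexCombination_le (fun j =>
    (Wmat τ nx nu Astar M (Astar - A j) Bstar (Bstar - B j)).trace / ((nu : ℝ) * τ)) i
  have hmin := ciInf_le (Set.finite_range fun j : Fin N => (1 / (τ : ℝ)) *
    ((SwMat τ nx Astar sqrtSigw)ᵀ * Qblk τ nx M (Astar - A j) *
      SwMat τ nx Astar sqrtSigw).trace).bddBelow i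
  simp only [trace_sum, trace_smul, smul_eq_mul, Finset.sum_div, mul_div_assoc]
  rw [hlhs, ge_iff_le]
  refine (add_le_add (mul_le_mul_of_nonneg_left hinf (sq_nonneg γ)) hmin).trans ?_
  have hτ0 : (0 : ℝ) < τ := by exact_mod_cast hτ
  have hnu0 : (0 : ℝ) < nu := by exact_mod_cast hnu
  have := mul_nonneg (one_div_nonneg.2 hτ0.le) hnonneg
  rw [mul_add, mul_add, ← hΔA, ← hΔB]
  have heq : γ ^ 2 * ((Wmat τ nx nu Astar M ΔA Bstar ΔB).trace / ((nu : ℝ) * τ))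
      = 1 / (τ : ℝ) * (γ ^ 2 / nu * (Wmat τ nx nu Astar M ΔA Bstar ΔB).trace) := by
    field_simp
  linarith
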